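/- Let F_1, …, F_7 ⊆ {1, …, 6} be the sets F_1 = {2,3,5}, F_2 = {3,4,6}, F_3 = {1,4,5}, F_4 = {1,2,6}, F_5 = {2,4,5,6}, F_6 = {1,3,5,6}, F_7 = {1,2,3,4}. Then there is no matrix S ∈ ℝ^{6×7} satisfying S_{ij} = 0 if i ∈ F_j, S_{ij} > 0 if i ∉ F_j, and rank(S) ≤ 4. -/

import Mathlib

open Matrix

/-- The vertex sets of the facets of the tetrahemihexahedron (0-indexed). -/
def F17 : Fin 7 → Finset (Fin 6) :=
  ![{1,2,4}, {2,3,5}, {0,3,4}, {0,1,5}, {1,3,4,5}, {0,2,4,5}, {0,1,2,3}]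

/-- The minor of a matrix with the support of `F17` on rows `0, 1, 2, 3, 4` and columns
`0, 1, 4, 5, 6` does not vanish: it is a sum of two positive monomials. -/
lemma det_submatrix_ne_zero_of_support_F17 (S : Matrix (Fin 6) (Fin 7) ℝ)
    (h0 : ∀ i j, i ∈ F17 j → S i j = 0) (hpos : ∀ i j, i ∉ F17 j → 0 < S i j) :
    (S.submatrix ![0, 1, 2, 3, 4] ![0, 1, 4, 5, 6]).det ≠ 0 := by
  have hS : S.submatrix ![0, 1, 2, 3, 4] ![0, 1, 4, 5, 6] =
      !![S 0 0, S 0 1, S 0 4, 0, 0;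
         0, S 1 1, 0, S 1 5, 0;
         0, 0, S 2 4, 0, 0;
         S 3 0, 0, 0, S 3 5, 0;
         0, S 4 1, 0, 0, S 4 6] := by
    ext i j
    fin_cases i <;> fin_cases j <;> first | rfl | exact h0 _ _ (by decide)
  have hdet : (S.submatrix ![0, 1, 2, 3, 4] ![0, 1, 4, 5, 6]).det =
      S 4 6 * S 2 4 * (S 0 0 * S 1 1 * S 3 5 + S 0 1 * S 1 5 * S 3 0) := by
    rw [hS]
    simp [Matrix.det_succ_row_zero, Fin.sum_univ_succ, Fin.succAbove]
    ring
  rw [hdet]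
  have h00 := hpos 0 0 (by decide)
  have h01 := hpos 0 1 (by decide)
  have h11 := hpos 1 1 (by decide)
  have h15 := hpos 1 5 (by decide)
  have h24 := hpos 2 4 (by decide)
  have h30 := hpos 3 0 (by decide)
  have h35 := hpos 3 5 (by decide)
  have h46 := hpos 4 6 (by decide)
  positivity

/-- there is no real `6 × 7` matrix of rank at most 4, with zeros
exactly at the incidences of the tetrahemihexahedron and strictly positive
entries elsewhere. -/
theorem statement_17 :
    ¬ ∃ S : Matrix (Fin 6) (Fin 7) ℝ,
        (∀ i j, i ∈ F17 j → S i j = 0) ∧ (∀ i j, i ∉ F17 j → 0 < S i j) ∧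
        S.rank ≤ 4 := by
  rintro ⟨S, h0, hpos, hrank⟩
  have hdet := det_submatrix_ne_zero_of_support_F17 S h0 hpos
  have hfull := Matrix.rank_of_det_ne_zero hdet
  have hle := S.rank_submatrix_le ![0, 1, 2, 3, 4] ![0, 1, 4, 5, 6]
  rw [hfull, Fintype.card_fin] at hle
  omega
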